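/- Let 𝕋² = (ℝ/ℤ) × (ℝ/ℤ) be the torus, let p ∈ 𝕋², and let V = 𝕋² ∖ {p} be the punctured torus with the subspace topology. Then for any base point x₀ ∈ V, the fundamental group π₁(V, x₀) is isomorphic to the free group on two generators. -/

import Mathlib

open CategoryTheory

attribute [local instance] Path.Homotopic.setoid

open scoped unitInterval

/-- The torus `(ℝ/ℤ) × (ℝ/ℤ)` with the point `p` removed. -/
abbrev PuncturedTorus (p : AddCircle (1 : ℝ) × AddCircle (1 : ℝ)) : Type :=
  ↥({p}ᶜ : Set (AddCircle (1 : ℝ) × AddCircle (1 : ℝ)))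

namespace PuncturedTorus

noncomputable section

/-- The representative in `[0, 1)` of a point of `ℝ/ℤ`. -/
def rep (z : AddCircle (1 : ℝ)) : ℝ := AddCircle.equivIco 1 0 z

lemma coe_rep (z : AddCircle (1 : ℝ)) : ((rep z : ℝ) : AddCircle (1 : ℝ)) = z :=
  AddCircle.coe_equivIco

lemma rep_nonneg (z : AddCircle (1 : ℝ)) : 0 ≤ rep z := (AddCircle.equivIco 1 0 z).2.1

lemma rep_lt_one (z : AddCircle (1 : ℝ)) : rep z < 1 := by
  simpa using! (AddCircle.equivIco 1 0 z).2.2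

lemma rep_pos {z : AddCircle (1 : ℝ)} (hz : z ≠ 0) : 0 < rep z := by
  refine (rep_nonneg z).lt_of_ne fun h ↦ hz ?_
  rw [← coe_rep z, ← h, AddCircle.coe_zero]

lemma rep_coe (x : ℝ) : rep (x : AddCircle (1 : ℝ)) = Int.fract x := by
  have h := AddCircle.coe_equivIco_mk_apply (1 : ℝ) x
  rwa [div_one, mul_one] at h

lemma rep_coe_of_mem {x : ℝ} (h₀ : 0 ≤ x) (h₁ : x < 1) : rep (x : AddCircle (1 : ℝ)) = x := by
  rw [rep_coe, Int.fract_eq_self.mpr ⟨h₀, h₁⟩]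

lemma continuousAt_rep {z : AddCircle (1 : ℝ)} (hz : z ≠ 0) : ContinuousAt rep z :=
  continuousAt_subtype_val.comp (AddCircle.continuousAt_equivIco 1 0 (by simpa using hz))

lemma coe_ne_zero_of_mem_Ioo {x : ℝ} (hx : x ∈ Set.Ioo (0 : ℝ) 1) :
    (x : AddCircle (1 : ℝ)) ≠ 0 := fun h ↦ by
  have := rep_coe_of_mem hx.1.le hx.2
  rw [h, ← AddCircle.coe_zero, rep_coe_of_mem le_rfl one_pos] at this
  exact hx.1.ne this

variable (p : AddCircle (1 : ℝ) × AddCircle (1 : ℝ))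

/-- The universal covering of the torus, with the origin sent to `p`. -/
def proj (P : ℝ × ℝ) : AddCircle (1 : ℝ) × AddCircle (1 : ℝ) := (p.1 + P.1, p.2 + P.2)

lemma continuous_proj : Continuous (proj p) :=
  (continuous_const.add ((AddCircle.continuous_mk' 1).comp continuous_fst)).prodMk
    (continuous_const.add ((AddCircle.continuous_mk' 1).comp continuous_snd))

/-- A set of the plane avoids the lattice if it does not meet the preimage of the puncture. -/
def Avoids (K : Set (ℝ × ℝ)) : Prop := ∀ P ∈ K, proj p P ≠ p

variable {p}

lemma Avoids.mono {K L : Set (ℝ × ℝ)} (hL : Avoids p L) (h : K ⊆ L) : Avoids p K :=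
  fun P hP ↦ hL P (h hP)

/-- The path `γ` is the projection of a path from `P` to `Q` lying in `K`. -/
def Lifts (K : Set (ℝ × ℝ)) (P Q : ℝ × ℝ) {u v : PuncturedTorus p} (γ : Path u v) : Prop :=
  ∃ Γ : Path P Q, ∀ t, Γ t ∈ K ∧ proj p (Γ t) = γ t

namespace Lifts

variable {K L : Set (ℝ × ℝ)} {P Q R : ℝ × ℝ} {u v w : PuncturedTorus p}

lemma mono {γ : Path u v} (h : Lifts K P Q γ) (hKL : K ⊆ L) : Lifts L P Q γ := by
  obtain ⟨Γ, hΓ⟩ := h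
  exact ⟨Γ, fun t ↦ ⟨hKL (hΓ t).1, (hΓ t).2⟩⟩

lemma refl (hP : P ∈ K) (hu : proj p P = u) : Lifts K P P (Path.refl u) :=
  ⟨Path.refl P, fun _ ↦ ⟨hP, hu⟩⟩

lemma symm {γ : Path u v} (h : Lifts K P Q γ) : Lifts K Q P γ.symm := by
  obtain ⟨Γ, hΓ⟩ := h
  exact ⟨Γ.symm, fun t ↦ hΓ _⟩

lemma trans {γ : Path u v} {δ : Path v w} (h : Lifts K P Q γ) (h' : Lifts K Q R δ) :
    Lifts K P R (γ.trans δ) := by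
  obtain ⟨Γ, hΓ⟩ := h
  obtain ⟨Δ, hΔ⟩ := h'
  refine ⟨Γ.trans Δ, fun t ↦ ?_⟩
  rw [Path.trans_apply, Path.trans_apply]
  split_ifs
  exacts [hΓ _, hΔ _]

/-- Two paths that lift to paths with the same end points in a convex set are homotopic. -/
lemma homotopic {γ δ : Path u v} (hK : Convex ℝ K) (hav : Avoids p K)
    (hγ : Lifts K P Q γ) (hδ : Lifts K P Q δ) : γ.Homotopic δ := by
  obtain ⟨Γ, hΓ⟩ := hγ
  obtain ⟨Δ, hΔ⟩ := hδ
  have hmem (s t : I) : AffineMap.lineMap (Γ t) (Δ t) (s : ℝ) ∈ K :=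
    hK.lineMap_mem (hΓ t).1 (hΔ t).1 s.2
  refine ⟨{
    toFun := fun st ↦ ⟨proj p (AffineMap.lineMap (Γ st.2) (Δ st.2) (st.1 : ℝ)),
      hav _ (hmem st.1 st.2)⟩
    continuous_toFun := ?_
    map_zero_left := fun t ↦ Subtype.ext (by simp [(hΓ t).2])
    map_one_left := fun t ↦ Subtype.ext (by simp [(hΔ t).2])
    prop' := ?_ }⟩
  · refine Continuous.subtype_mk ((continuous_proj p).comp ?_) _
    simp only [AffineMap.lineMap_apply_module]
    fun_prop
  · rintro s t (rfl | rfl)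
    · refine Subtype.ext ?_
      simpa using (hΓ 0).2
    · refine Subtype.ext ?_
      simpa using (hΓ 1).2

lemma exists_of_segment (hav : Avoids p (segment ℝ P Q)) (hu : proj p P = u)
    (hv : proj p Q = v) : ∃ γ : Path u v, Lifts (segment ℝ P Q) P Q γ := by
  have hmem (t : I) : AffineMap.lineMap P Q (t : ℝ) ∈ segment ℝ P Q :=
    (convex_segment P Q).lineMap_mem (left_mem_segment ℝ P Q) (right_mem_segment ℝ P Q) t.2
  let Γ : Path P Q :=
    { toFun := fun t ↦ AffineMap.lineMap P Q (t : ℝ)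
      continuous_toFun := by
        simp only [AffineMap.lineMap_apply_module]
        fun_prop
      source' := by simp
      target' := by simp }
  refine ⟨{
    toFun := fun t ↦ ⟨proj p (Γ t), hav _ (hmem t)⟩
    continuous_toFun := ((continuous_proj p).comp Γ.continuous).subtype_mk _
    source' := Subtype.ext (by simp [hu])
    target' := Subtype.ext (by simp [hv]) }, Γ, fun t ↦ ⟨hmem t, rfl⟩⟩

lemma exists_of_convex (hK : Convex ℝ K) (hav : Avoids p K) (hP : P ∈ K) (hQ : Q ∈ K)
    (hu : proj p P = u) (hv : proj p Q = v) : ∃ γ : Path u v, Lifts K P Q γ := by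
  have hsub := hK.segment_subset hP hQ
  obtain ⟨γ, hγ⟩ := exists_of_segment (hav.mono hsub) hu hv
  exact ⟨γ, hγ.mono hsub⟩

end Lifts

/-- The vertical strip `(0, 1) × ℝ`. -/
def verticalStrip : Set (ℝ × ℝ) := Set.Ioo 0 1 ×ˢ Set.univ

/-- The horizontal strip `ℝ × (0, 1)`. -/
def horizontalStrip : Set (ℝ × ℝ) := Set.univ ×ˢ Set.Ioo 0 1

lemma convex_verticalStrip : Convex ℝ verticalStrip := (convex_Ioo 0 1).prod convex_univ

lemma convex_horizontalStrip : Convex ℝ horizontalStrip := convex_univ.prod (convex_Ioo 0 1)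

lemma avoids_verticalStrip : Avoids p verticalStrip := fun P hP h ↦
  coe_ne_zero_of_mem_Ioo hP.1 (by simpa [proj] using congrArg Prod.fst h)

lemma avoids_horizontalStrip : Avoids p horizontalStrip := fun P hP h ↦
  coe_ne_zero_of_mem_Ioo hP.2 (by simpa [proj] using congrArg Prod.snd h)

variable (p) in
/-- Translations by multiples of `e` preserve `K` and lie over the identity of the torus. -/
structure IsPeriod (K : Set (ℝ × ℝ)) (e : ℝ × ℝ) : Prop where
  add_zsmul_mem : ∀ P ∈ K, ∀ n : ℤ, P + n • e ∈ K
  proj_add_zsmul : ∀ (P : ℝ × ℝ) (n : ℤ), proj p (P + n • e) = proj p P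

lemma isPeriod_verticalStrip : IsPeriod p verticalStrip (0, 1) where
  add_zsmul_mem P hP n := by simpa [verticalStrip] using hP
  proj_add_zsmul P n := by simp [proj]

lemma isPeriod_horizontalStrip : IsPeriod p horizontalStrip (1, 0) where
  add_zsmul_mem P hP n := by simpa [horizontalStrip] using hP
  proj_add_zsmul P n := by simp [proj]

lemma Lifts.add_zsmul {K : Set (ℝ × ℝ)} {P Q e : ℝ × ℝ} {u v : PuncturedTorus p} {γ : Path u v}
    (h : Lifts K P Q γ) (he : IsPeriod p K e) (n : ℤ) :
    Lifts K (P + n • e) (Q + n • e) γ := by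
  obtain ⟨Γ, hΓ⟩ := h
  exact ⟨Γ.map (continuous_id.add continuous_const), fun t ↦
    ⟨he.add_zsmul_mem _ (hΓ t).1 n, (he.proj_add_zsmul _ n).trans (hΓ t).2⟩⟩

/-- The lift of the base point. -/
def center : ℝ × ℝ := (1 / 4, 1 / 4)

lemma center_mem_verticalStrip : center ∈ verticalStrip := by
  norm_num [center, verticalStrip]

lemma center_mem_horizontalStrip : center ∈ horizontalStrip := by
  norm_num [center, horizontalStrip]

variable (p) in
/-- The base point of the punctured torus. -/
def base : PuncturedTorus p := ⟨proj p center, avoids_verticalStrip _ center_mem_verticalStrip⟩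

/-- The representative in `[0, 1) × [0, 1)` of a point of the punctured torus. -/
def repr (v : PuncturedTorus p) : ℝ × ℝ := (rep (v.1.1 - p.1), rep (v.1.2 - p.2))

lemma proj_repr (v : PuncturedTorus p) : proj p (repr v) = v := by
  simp [proj, repr, coe_rep]

lemma repr_base : repr (base p) = center := by
  simp only [repr, base, proj, center, add_sub_cancel_left]
  rw [rep_coe_of_mem (by norm_num) (by norm_num)]

lemma repr_mem_verticalStrip {v : PuncturedTorus p} (hv : v.1.1 ≠ p.1) :
    repr v ∈ verticalStrip :=
  ⟨⟨rep_pos (sub_ne_zero.mpr hv), rep_lt_one _⟩, trivial⟩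

lemma repr_mem_horizontalStrip {v : PuncturedTorus p} (hv : v.1.2 ≠ p.2) :
    repr v ∈ horizontalStrip :=
  ⟨trivial, rep_pos (sub_ne_zero.mpr hv), rep_lt_one _⟩

lemma fst_ne_or_snd_ne (v : PuncturedTorus p) : v.1.1 ≠ p.1 ∨ v.1.2 ≠ p.2 := by
  by_contra! h
  exact v.2 (Prod.ext h.1 h.2)

lemma avoids_segment_repr (v : PuncturedTorus p) : Avoids p (segment ℝ center (repr v)) := by
  rcases fst_ne_or_snd_ne v with hv | hv
  · exact avoids_verticalStrip.mono (convex_verticalStrip.segment_subset center_mem_verticalStrip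
      (repr_mem_verticalStrip hv))
  · exact avoids_horizontalStrip.mono (convex_horizontalStrip.segment_subset
      center_mem_horizontalStrip (repr_mem_horizontalStrip hv))

/-- The straight path, within the unit square, from the base point to `v`. -/
def radial (v : PuncturedTorus p) : Path (base p) v :=
  (Lifts.exists_of_segment (avoids_segment_repr v) rfl (proj_repr v)).choose

lemma lifts_radial (v : PuncturedTorus p) :
    Lifts (segment ℝ center (repr v)) center (repr v) (radial v) :=
  (Lifts.exists_of_segment (avoids_segment_repr v) rfl (proj_repr v)).choose_spec

lemma exists_lift_circle (f : C(I, AddCircle (1 : ℝ))) :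
    ∃ Γ : C(I, ℝ), Γ 0 = rep (f 0) ∧ ∀ t, (Γ t : AddCircle (1 : ℝ)) = f t := by
  obtain ⟨Γ, hΓ, h₀⟩ := (AddCircle.isCoveringMap_coe (1 : ℝ)).exists_path_lifts f (rep (f 0))
    (coe_rep _).symm
  exact ⟨Γ, h₀, fun t ↦ congrFun hΓ t⟩

lemma exists_eq_rep_add_int {x : ℝ} {z : AddCircle (1 : ℝ)} (h : (x : AddCircle (1 : ℝ)) = z) :
    ∃ n : ℤ, x = rep z + n :=
  ⟨⌊x⌋, by rw [← h, rep_coe, Int.fract_add_floor]⟩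

lemma exists_lifts_vertical {u v : PuncturedTorus p} (γ : Path u v)
    (hγ : ∀ t, (γ t).1.1 ≠ p.1) :
    ∃ n : ℤ, Lifts verticalStrip (repr u) (repr v + n • (0, 1)) γ := by
  have hcont : Continuous fun t ↦ rep ((γ t).1.1 - p.1) :=
    continuous_iff_continuousAt.mpr fun t ↦
      ContinuousAt.comp (f := fun t ↦ (γ t).1.1 - p.1)
        (continuousAt_rep (sub_ne_zero.mpr (hγ t))) (by fun_prop)
  obtain ⟨Γ, h₀, hΓ⟩ := exists_lift_circle ⟨fun t ↦ (γ t).1.2 - p.2, by fun_prop⟩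
  obtain ⟨n, hn⟩ := exists_eq_rep_add_int (hΓ 1)
  refine ⟨n, ⟨⟨fun t ↦ (rep ((γ t).1.1 - p.1), Γ t), by fun_prop⟩, ?_, ?_⟩, fun t ↦
    ⟨⟨⟨rep_pos (sub_ne_zero.mpr (hγ t)), rep_lt_one _⟩, trivial⟩, ?_⟩⟩
  · simpa [repr] using h₀
  · simpa [repr] using hn
  · have := hΓ t
    simp_all [proj, coe_rep]

lemma exists_lifts_horizontal {u v : PuncturedTorus p} (γ : Path u v)
    (hγ : ∀ t, (γ t).1.2 ≠ p.2) :
    ∃ n : ℤ, Lifts horizontalStrip (repr u) (repr v + n • (1, 0)) γ := by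
  have hcont : Continuous fun t ↦ rep ((γ t).1.2 - p.2) :=
    continuous_iff_continuousAt.mpr fun t ↦
      ContinuousAt.comp (f := fun t ↦ (γ t).1.2 - p.2)
        (continuousAt_rep (sub_ne_zero.mpr (hγ t))) (by fun_prop)
  obtain ⟨Γ, h₀, hΓ⟩ := exists_lift_circle ⟨fun t ↦ (γ t).1.1 - p.1, by fun_prop⟩
  obtain ⟨n, hn⟩ := exists_eq_rep_add_int (hΓ 1)
  refine ⟨n, ⟨⟨fun t ↦ (Γ t, rep ((γ t).1.2 - p.2)), by fun_prop⟩, ?_, ?_⟩, fun t ↦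
    ⟨⟨trivial, rep_pos (sub_ne_zero.mpr (hγ t)), rep_lt_one _⟩, ?_⟩⟩
  · simpa [repr] using h₀
  · simpa [repr] using hn
  · have := hΓ t
    simp_all [proj, coe_rep]

/-- The element of the fundamental group represented by a loop. -/
def loopClass (γ : Path (base p) (base p)) : FundamentalGroup (PuncturedTorus p) (base p) :=
  Path.Homotopic.Quotient.mk γ

lemma mk_eq_zpow {K : Set (ℝ × ℝ)} {e : ℝ × ℝ} (hK : Convex ℝ K) (hav : Avoids p K)
    (he : IsPeriod p K e) (hc : center ∈ K) {β γ : Path (base p) (base p)} {n : ℤ}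
    (hβ : Lifts K center (center + e) β) (hγ : Lifts K center (center + n • e) γ) :
    loopClass γ =
      loopClass β ^ n := by
  suffices h : ∃ δ : Path (base p) (base p), Lifts K center (center + n • e) δ ∧
      loopClass δ =
        loopClass β ^ n by
    obtain ⟨δ, hδ, h⟩ := h
    rw [← h]
    exact Path.Homotopic.Quotient.eq.mpr (hγ.homotopic hK hav hδ)
  clear hγ γ
  induction n with
  | zero => exact ⟨Path.refl _, by simpa using Lifts.refl hc rfl, by rw [zpow_zero]; rfl⟩
  | succ n ih =>
    obtain ⟨δ, hδ, h⟩ := ih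
    refine ⟨δ.trans β, hδ.trans ?_, ?_⟩
    · convert! hβ.add_zsmul he n using 1
      module
    · rw [add_comm, zpow_one_add, ← h]
      rfl
  | pred n ih =>
    obtain ⟨δ, hδ, h⟩ := ih
    refine ⟨δ.trans β.symm, hδ.trans ?_, ?_⟩
    · convert! hβ.symm.add_zsmul he (-n - 1) using 1
      module
    · rw [sub_eq_neg_add, zpow_add, zpow_neg_one, ← h]
      rfl

/-- Close up a homotopy class of paths with radial paths to a loop at the base point. -/
def toLoop {u v : PuncturedTorus p} (γ : Path.Homotopic.Quotient u v) :
    FundamentalGroup (PuncturedTorus p) (base p) :=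
  ((Path.Homotopic.Quotient.mk (radial u)).trans γ).trans
    (Path.Homotopic.Quotient.mk (radial v)).symm

lemma toLoop_trans {u v w : PuncturedTorus p} (γ : Path.Homotopic.Quotient u v)
    (δ : Path.Homotopic.Quotient v w) : toLoop (γ.trans δ) = toLoop δ * toLoop γ := by
  have h : (Path.Homotopic.Quotient.mk (radial v)).symm.trans
      ((Path.Homotopic.Quotient.mk (radial v)).trans
        (δ.trans (Path.Homotopic.Quotient.mk (radial w)).symm)) =
      δ.trans (Path.Homotopic.Quotient.mk (radial w)).symm := by
    rw [← Path.Homotopic.Quotient.trans_assoc, Path.Homotopic.Quotient.symm_trans,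
      Path.Homotopic.Quotient.refl_trans]
  simp only [FundamentalGroup.mul_def, toLoop, Path.Homotopic.Quotient.trans_assoc]
  rw [h]

lemma toLoop_refl (u : PuncturedTorus p) : toLoop (Path.Homotopic.Quotient.refl u) = 1 := by
  simp only [FundamentalGroup.one_def, toLoop, Path.Homotopic.Quotient.trans_refl,
    Path.Homotopic.Quotient.trans_symm]

lemma mk_radial_base :
    Path.Homotopic.Quotient.mk (radial (base p)) = Path.Homotopic.Quotient.refl (base p) := by
  have h := lifts_radial (base p)
  have hav := avoids_segment_repr (base p)
  rw [repr_base] at h hav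
  exact Path.Homotopic.Quotient.eq.mpr
    (h.homotopic (convex_segment _ _) hav (Lifts.refl (left_mem_segment ℝ _ _) rfl))

lemma toLoop_base (γ : Path.Homotopic.Quotient (base p) (base p)) : toLoop γ = γ := by
  rw [toLoop, mk_radial_base, Path.Homotopic.Quotient.refl_trans]
  exact (Path.Homotopic.Quotient.trans_refl _)

lemma toLoop_eq_zpow {K : Set (ℝ × ℝ)} {e : ℝ × ℝ} (hK : Convex ℝ K) (hav : Avoids p K)
    (he : IsPeriod p K e) (hc : center ∈ K) {β : Path (base p) (base p)}
    (hβ : Lifts K center (center + e) β) {u v : PuncturedTorus p} {γ : Path u v} {n : ℤ}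
    (hu : repr u ∈ K) (hv : repr v ∈ K) (hγ : Lifts K (repr u) (repr v + n • e) γ) :
    toLoop (Path.Homotopic.Quotient.mk γ) =
      loopClass β ^ n := by
  rw [← mk_eq_zpow hK hav he hc (γ := ((radial u).trans γ).trans (radial v).symm) hβ]
  · rfl
  · exact (((lifts_radial u).mono (hK.segment_subset hc hu)).trans hγ).trans
      (((lifts_radial v).mono (hK.segment_subset hc hv)).symm.add_zsmul he n)

/-- Loops crossing the two edges of the unit square once generate the fundamental group. -/
theorem mem_of_lifts {α β : Path (base p) (base p)}
    (hα : Lifts horizontalStrip center (center + (1, 0)) α)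
    (hβ : Lifts verticalStrip center (center + (0, 1)) β)
    {H : Subgroup (FundamentalGroup (PuncturedTorus p) (base p))}
    (hαH : loopClass α ∈ H) (hβH : loopClass β ∈ H)
    (g : FundamentalGroup (PuncturedTorus p) (base p)) : g ∈ H := by
  have hV {u v : PuncturedTorus p} (γ : Path u v) (hγ : ∀ t, (γ t).1.1 ≠ p.1) :
      toLoop (Path.Homotopic.Quotient.mk γ) ∈ H := by
    obtain ⟨n, hn⟩ := exists_lifts_vertical γ hγ
    rw [toLoop_eq_zpow convex_verticalStrip avoids_verticalStrip isPeriod_verticalStrip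
      center_mem_verticalStrip hβ (repr_mem_verticalStrip (by simpa using hγ 0))
      (repr_mem_verticalStrip (by simpa using hγ 1)) hn]
    exact H.zpow_mem hβH n
  have hH {u v : PuncturedTorus p} (γ : Path u v) (hγ : ∀ t, (γ t).1.2 ≠ p.2) :
      toLoop (Path.Homotopic.Quotient.mk γ) ∈ H := by
    obtain ⟨n, hn⟩ := exists_lifts_horizontal γ hγ
    rw [toLoop_eq_zpow convex_horizontalStrip avoids_horizontalStrip isPeriod_horizontalStrip
      center_mem_horizontalStrip hα (repr_mem_horizontalStrip (by simpa using hγ 0))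
      (repr_mem_horizontalStrip (by simpa using hγ 1)) hn]
    exact H.zpow_mem hαH n
  obtain ⟨γ, rfl⟩ := Path.Homotopic.Quotient.mk_surjective g
  let c : Bool → Set I := fun b ↦ cond b {t | (γ t).1.1 ≠ p.1} {t | (γ t).1.2 ≠ p.2}
  have hc : ∀ b, IsOpen (c b) := by
    rintro (_ | _)
    · exact isOpen_ne_fun (by fun_prop) continuous_const
    · exact isOpen_ne_fun (by fun_prop) continuous_const
  have hcover : Set.univ ⊆ ⋃ b, c b := fun t _ ↦ Set.mem_iUnion.mpr <|
    (fst_ne_or_snd_ne (γ t)).elim (fun h ↦ ⟨true, h⟩) (fun h ↦ ⟨false, h⟩)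
  obtain ⟨t, ht₀, hmono, ⟨m, hm⟩, ht⟩ :=
    exists_monotone_Icc_subset_open_cover_unitInterval hc hcover
  have hind (n : ℕ) : toLoop (Path.Homotopic.Quotient.mk (γ.subpath (t 0) (t n))) ∈ H := by
    induction n with
    | zero =>
      rw [Path.subpath_self, Path.Homotopic.Quotient.mk_refl, toLoop_refl]
      exact H.one_mem
    | succ n ih =>
      rw [← Path.Homotopic.Quotient.eq.mpr
        ⟨Path.Homotopy.subpathTransSubpath γ (t 0) (t n) (t (n + 1))⟩,
        Path.Homotopic.Quotient.mk_trans, toLoop_trans]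
      refine H.mul_mem ?_ ih
      have hmem (s : I) : γ.subpath (t n) (t (n + 1)) s ∈ γ '' Set.Icc (t n) (t (n + 1)) := by
        rw [← Path.range_subpath_of_le γ _ _ (hmono n.le_succ)]
        exact Set.mem_range_self s
      obtain ⟨_ | _, hb⟩ := ht n
      · refine hH _ fun s ↦ ?_
        obtain ⟨r, hr, hrs⟩ := hmem s
        rw [← hrs]
        exact hb hr
      · refine hV _ fun s ↦ ?_
        obtain ⟨r, hr, hrs⟩ := hmem s
        rw [← hrs]
        exact hb hr
  have key := hind m
  rw [ht₀, hm m le_rfl, Path.subpath_zero_one] at key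
  have hcast {u v : PuncturedTorus p} (hu : u = base p) (hv : v = base p) :
      toLoop (Path.Homotopic.Quotient.mk (γ.cast hu hv)) = Path.Homotopic.Quotient.mk γ := by
    subst hu hv
    exact toLoop_base _
  rwa [hcast] at key

/-- Indices of an atlas trivializing a principal bundle on the punctured torus. -/
inductive Chart
  | square
  | vertical
  | horizontal

variable (p) in
/-- The open square, and neighbourhoods of the open edges of the square. -/
def Chart.baseSet : Chart → Set (PuncturedTorus p)
  | .square => {v | v.1.1 ≠ p.1 ∧ v.1.2 ≠ p.2}
  | .vertical => {v | v.1.1 ≠ p.1 ∧ v.1.2 - p.2 ≠ ((1 / 2 : ℝ) : AddCircle (1 : ℝ))}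
  | .horizontal => {v | v.1.1 - p.1 ≠ ((1 / 2 : ℝ) : AddCircle (1 : ℝ)) ∧ v.1.2 ≠ p.2}

lemma Chart.isOpen_baseSet (i : Chart) : IsOpen (i.baseSet p) := by
  cases i <;>
    exact (isOpen_ne_fun (by fun_prop) continuous_const).inter
      (isOpen_ne_fun (by fun_prop) continuous_const)

lemma zero_ne_coe_half : (0 : AddCircle (1 : ℝ)) ≠ ((1 / 2 : ℝ) : AddCircle (1 : ℝ)) :=
  (coe_ne_zero_of_mem_Ioo (by norm_num)).symm

lemma Chart.exists_mem_baseSet (v : PuncturedTorus p) : ∃ i : Chart, v ∈ i.baseSet p := by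
  by_cases h₁ : v.1.1 = p.1
  · exact ⟨.horizontal, by rw [h₁, sub_self]; exact zero_ne_coe_half,
      (fst_ne_or_snd_ne v).resolve_left (not_not.mpr h₁)⟩
  · by_cases h₂ : v.1.2 = p.2
    · exact ⟨.vertical, h₁, by rw [h₂, sub_self]; exact zero_ne_coe_half⟩
    · exact ⟨.square, h₁, h₂⟩

lemma Chart.mem_square_of_ne {i j : Chart} (hij : i ≠ j) {v : PuncturedTorus p}
    (hi : v ∈ i.baseSet p) (hj : v ∈ j.baseSet p) : v ∈ Chart.square.baseSet p := by
  cases i <;> cases j <;> first | exact absurd rfl hij | exact hi | exact hj | skip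
  · exact ⟨hi.1, hj.2⟩
  · exact ⟨hj.1, hi.2⟩

section Bundle

variable {G : Type*} [Group G] (a b : G)

/-- The transition from the square to the chart `i`. -/
def transition : Chart → PuncturedTorus p → G
  | .square, _ => 1
  | .vertical, v => if 1 / 2 < rep (v.1.2 - p.2) then b else 1
  | .horizontal, v => if 1 / 2 < rep (v.1.1 - p.1) then a else 1

lemma eventually_half_lt_rep_iff {X : Type*} [TopologicalSpace X] {z : X → AddCircle (1 : ℝ)}
    {x : X} (hz : ContinuousAt z x) (h₀ : z x ≠ 0)
    (h₁ : z x ≠ ((1 / 2 : ℝ) : AddCircle (1 : ℝ))) :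
    ∀ᶠ y in nhds x, (1 / 2 < rep (z y) ↔ 1 / 2 < rep (z x)) := by
  have hc : ContinuousAt (fun y ↦ rep (z y)) x := (continuousAt_rep h₀).comp hz
  have hne : rep (z x) ≠ 1 / 2 := fun h ↦ h₁ (by rw [← h, coe_rep])
  rcases lt_or_gt_of_ne hne with h | h
  · filter_upwards [hc.eventually_lt_const h] with y hy
    exact iff_of_false hy.not_gt h.not_gt
  · filter_upwards [hc.eventually_const_lt h] with y hy
    exact iff_of_true hy h

lemma eventually_transition_eq {i : Chart} {v : PuncturedTorus p} (hi : v ∈ i.baseSet p)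
    (hv : v ∈ Chart.square.baseSet p) :
    ∀ᶠ w in nhds v, transition a b i w = transition a b i v := by
  cases i with
  | square => exact Filter.Eventually.of_forall fun _ ↦ rfl
  | vertical =>
    filter_upwards [eventually_half_lt_rep_iff (z := fun w : PuncturedTorus p ↦ w.1.2 - p.2)
      (by fun_prop) (sub_ne_zero.mpr hv.2) hi.2] with w hw
    simp only [transition, hw]
  | horizontal =>
    filter_upwards [eventually_half_lt_rep_iff (z := fun w : PuncturedTorus p ↦ w.1.1 - p.1)
      (by fun_prop) (sub_ne_zero.mpr hv.1) hi.1] with w hw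
    simp only [transition, hw]

variable [TopologicalSpace G] [DiscreteTopology G]

variable (p) in
/-- The principal bundle over the punctured torus with monodromy `a` along the horizontal loop and
`b` along the vertical loop. -/
def bundle : FiberBundleCore Chart (PuncturedTorus p) G where
  baseSet i := i.baseSet p
  isOpen_baseSet i := i.isOpen_baseSet
  indexAt v := (Chart.exists_mem_baseSet v).choose
  mem_baseSet_at v := (Chart.exists_mem_baseSet v).choose_spec
  coordChange i j v g := transition a b j v * (transition a b i v)⁻¹ * g
  coordChange_self i v _ g := by simp
  continuousOn_coordChange i j := by
    rintro ⟨v, g⟩ ⟨⟨hi, hj⟩, -⟩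
    refine ContinuousAt.continuousWithinAt ?_
    by_cases hij : i = j
    · subst hij
      simpa using continuousAt_snd
    · have hv := Chart.mem_square_of_ne hij hi hj
      refine ContinuousAt.congr (f := fun q : PuncturedTorus p × G ↦
        transition a b j v * (transition a b i v)⁻¹ * q.2)
        ((continuous_of_discreteTopology (f := fun g : G ↦
          transition a b j v * (transition a b i v)⁻¹ * g)).comp continuous_snd).continuousAt ?_
      filter_upwards [continuousAt_fst.eventually (eventually_transition_eq a b hi hv),
        continuousAt_fst.eventually (eventually_transition_eq a b hj hv)] with q h₁ h₂
      rw [h₁, h₂]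
  coordChange_comp i j k v _ g := by group

variable (p) in
lemma isCoveringMap_bundle : IsCoveringMap (bundle p a b).proj :=
  IsFiberBundle.isCoveringMap fun v ↦
    ⟨(bundle p a b).localTriv ((bundle p a b).indexAt v), (bundle p a b).mem_baseSet_at v⟩

/-- The point over `v` with coordinate `g` in the chart `i`. -/
def fiberPoint (i : Chart) (v : PuncturedTorus p) (g : G) : (bundle p a b).proj ⁻¹' {v} :=
  ⟨⟨v, (bundle p a b).coordChange i ((bundle p a b).indexAt v) v g⟩, rfl⟩

lemma fiberPoint_eq (i j : Chart) (v : PuncturedTorus p) (g : G) :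
    fiberPoint a b i v g =
      fiberPoint a b j v (transition a b j v * (transition a b i v)⁻¹ * g) := by
  refine Subtype.ext (congrArg (Bundle.TotalSpace.mk v) ?_)
  have h (x y z : G) : x * y⁻¹ * g = x * z⁻¹ * (z * y⁻¹ * g) := by group
  exact h _ _ _

lemma fiberPoint_injective (i : Chart) (v : PuncturedTorus p) :
    Function.Injective (fiberPoint a b i v) := fun g h hgh ↦ by
  have h := Bundle.TotalSpace.mk_injective v (congrArg Subtype.val hgh)
  exact mul_left_cancel h

lemma monodromy_fiberPoint {i : Chart} {u v : PuncturedTorus p} {γ : Path u v}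
    (hγ : ∀ t, γ t ∈ i.baseSet p) (g : G) :
    (isCoveringMap_bundle p a b).monodromy (Path.Homotopic.Quotient.mk γ) (fiberPoint a b i u g) =
      fiberPoint a b i v g := by
  let Γ : Path (fiberPoint a b i u g).1 (fiberPoint a b i v g).1 :=
    { toFun := fun t ↦ (fiberPoint a b i (γ t) g).1
      continuous_toFun := ((bundle p a b).localTriv i).continuousOn_invFun.comp_continuous
        (f := fun t ↦ (γ t, g)) (by fun_prop) fun t ↦ ⟨hγ t, trivial⟩
      source' := by rw [γ.source]
      target' := by rw [γ.target] }
  exact (isCoveringMap_bundle p a b).monodromy_eq_of_map_eq (Path.Homotopic.Quotient.mk Γ) rfl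

end Bundle

section Loops

variable {G : Type*} [Group G] (a b : G) [TopologicalSpace G] [DiscreteTopology G]

/-- The open unit square. -/
def unitSquare : Set (ℝ × ℝ) := Set.Ioo 0 1 ×ˢ Set.Ioo 0 1

lemma unitSquare_subset_verticalStrip : unitSquare ⊆ verticalStrip :=
  Set.prod_mono_right (Set.subset_univ _)

lemma unitSquare_subset_horizontalStrip : unitSquare ⊆ horizontalStrip :=
  Set.prod_mono_left (Set.subset_univ _)

lemma convex_unitSquare : Convex ℝ unitSquare := (convex_Ioo 0 1).prod (convex_Ioo 0 1)

lemma coe_ne_coe_half {x : ℝ} (hx : x ∈ Set.Ioo (1 / 2 : ℝ) (3 / 2)) :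
    (x : AddCircle (1 : ℝ)) ≠ ((1 / 2 : ℝ) : AddCircle (1 : ℝ)) := fun h ↦
  coe_ne_zero_of_mem_Ioo (x := x - 1 / 2) ⟨by linarith [hx.1], by linarith [hx.2]⟩
    (by rw [AddCircle.coe_sub, h, sub_self])

lemma mem_square_of_proj_eq {P : ℝ × ℝ} (hP : P ∈ unitSquare) {v : PuncturedTorus p}
    (h : proj p P = v) : v ∈ Chart.square.baseSet p := by
  change v.1.1 ≠ p.1 ∧ v.1.2 ≠ p.2
  rw [← h]
  simpa [proj] using
    And.intro (coe_ne_zero_of_mem_Ioo hP.1) (coe_ne_zero_of_mem_Ioo hP.2)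

lemma exists_verticalLoop : ∃ β : Path (base p) (base p),
    Lifts verticalStrip center (center + (0, 1)) β ∧
    ∀ g : G, (isCoveringMap_bundle p a b).monodromy (Path.Homotopic.Quotient.mk β)
      (fiberPoint a b .square (base p) g) = fiberPoint a b .square (base p) (b * g) := by
  have hm : ((1 / 4, 3 / 4) : ℝ × ℝ) ∈ unitSquare := by norm_num [unitSquare]
  let K : Set (ℝ × ℝ) := Set.Ioo 0 1 ×ˢ Set.Ioo (1 / 2) (3 / 2)
  have hK : K ⊆ verticalStrip := Set.prod_mono_right (Set.subset_univ _)
  let m : PuncturedTorus p :=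
    ⟨proj p (1 / 4, 3 / 4), avoids_verticalStrip _ (unitSquare_subset_verticalStrip hm)⟩
  obtain ⟨γ, hγ⟩ := Lifts.exists_of_convex (u := base p) (v := m) (P := center)
    convex_unitSquare (avoids_verticalStrip.mono unitSquare_subset_verticalStrip)
    (by norm_num [unitSquare, center]) hm rfl rfl
  obtain ⟨δ, hδ⟩ := Lifts.exists_of_convex (u := m) (v := base p) (P := (1 / 4, 3 / 4))
    (Q := center + (0, 1)) (K := K) ((convex_Ioo 0 1).prod (convex_Ioo _ _))
    (avoids_verticalStrip.mono hK) (by norm_num [K]) (by norm_num [K, center]) rfl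
    (by simpa using! isPeriod_verticalStrip.proj_add_zsmul center 1)
  refine ⟨γ.trans δ, (hγ.mono unitSquare_subset_verticalStrip).trans (hδ.mono hK), fun g ↦ ?_⟩
  obtain ⟨Γ, hΓ⟩ := hγ
  obtain ⟨Δ, hΔ⟩ := hδ
  have hΔmem (t : I) : δ t ∈ Chart.vertical.baseSet p := by
    change (δ t).1.1 ≠ p.1 ∧ (δ t).1.2 - p.2 ≠ _
    rw [← (hΔ t).2]
    simpa [proj] using
      And.intro (coe_ne_zero_of_mem_Ioo (hΔ t).1.1) (coe_ne_coe_half (hΔ t).1.2)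
  have htm : transition a b .vertical m = b := by
    simp only [transition, m, proj, add_sub_cancel_left]
    rw [rep_coe_of_mem (by norm_num) (by norm_num), if_pos (by norm_num)]
  have htb : transition a b .vertical (base p) = 1 := by
    simp only [transition, base, proj, center, add_sub_cancel_left]
    rw [rep_coe_of_mem (by norm_num) (by norm_num), if_neg (by norm_num)]
  rw [Path.Homotopic.Quotient.mk_trans, IsCoveringMap.monodromy_trans_apply,
    monodromy_fiberPoint a b fun t ↦ mem_square_of_proj_eq (hΓ t).1 (hΓ t).2,
    fiberPoint_eq a b .square .vertical, monodromy_fiberPoint a b hΔmem,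
    fiberPoint_eq a b .vertical .square, htm, htb]
  simp [transition]

lemma exists_horizontalLoop : ∃ α : Path (base p) (base p),
    Lifts horizontalStrip center (center + (1, 0)) α ∧
    ∀ g : G, (isCoveringMap_bundle p a b).monodromy (Path.Homotopic.Quotient.mk α)
      (fiberPoint a b .square (base p) g) = fiberPoint a b .square (base p) (a * g) := by
  have hm : ((3 / 4, 1 / 4) : ℝ × ℝ) ∈ unitSquare := by norm_num [unitSquare]
  let K : Set (ℝ × ℝ) := Set.Ioo (1 / 2) (3 / 2) ×ˢ Set.Ioo 0 1
  have hK : K ⊆ horizontalStrip := Set.prod_mono_left (Set.subset_univ _)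
  let m : PuncturedTorus p :=
    ⟨proj p (3 / 4, 1 / 4), avoids_horizontalStrip _ (unitSquare_subset_horizontalStrip hm)⟩
  obtain ⟨γ, hγ⟩ := Lifts.exists_of_convex (u := base p) (v := m) (P := center)
    convex_unitSquare (avoids_horizontalStrip.mono unitSquare_subset_horizontalStrip)
    (by norm_num [unitSquare, center]) hm rfl rfl
  obtain ⟨δ, hδ⟩ := Lifts.exists_of_convex (u := m) (v := base p) (P := (3 / 4, 1 / 4))
    (Q := center + (1, 0)) (K := K) ((convex_Ioo _ _).prod (convex_Ioo 0 1))
    (avoids_horizontalStrip.mono hK) (by norm_num [K]) (by norm_num [K, center]) rfl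
    (by simpa using! isPeriod_horizontalStrip.proj_add_zsmul center 1)
  refine ⟨γ.trans δ, (hγ.mono unitSquare_subset_horizontalStrip).trans (hδ.mono hK), fun g ↦ ?_⟩
  obtain ⟨Γ, hΓ⟩ := hγ
  obtain ⟨Δ, hΔ⟩ := hδ
  have hΔmem (t : I) : δ t ∈ Chart.horizontal.baseSet p := by
    change (δ t).1.1 - p.1 ≠ _ ∧ (δ t).1.2 ≠ p.2
    rw [← (hΔ t).2]
    simpa [proj] using
      And.intro (coe_ne_coe_half (hΔ t).1.1) (coe_ne_zero_of_mem_Ioo (hΔ t).1.2)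
  have htm : transition a b .horizontal m = a := by
    simp only [transition, m, proj, add_sub_cancel_left]
    rw [rep_coe_of_mem (by norm_num) (by norm_num), if_pos (by norm_num)]
  have htb : transition a b .horizontal (base p) = 1 := by
    simp only [transition, base, proj, center, add_sub_cancel_left]
    rw [rep_coe_of_mem (by norm_num) (by norm_num), if_neg (by norm_num)]
  rw [Path.Homotopic.Quotient.mk_trans, IsCoveringMap.monodromy_trans_apply,
    monodromy_fiberPoint a b fun t ↦ mem_square_of_proj_eq (hΓ t).1 (hΓ t).2,
    fiberPoint_eq a b .square .horizontal, monodromy_fiberPoint a b hΔmem,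
    fiberPoint_eq a b .horizontal .square, htm, htb]
  simp [transition]

end Loops

variable (p) in
theorem nonempty_freeGroup_mulEquiv_base :
    Nonempty (FreeGroup (Fin 2) ≃* FundamentalGroup (PuncturedTorus p) (base p)) := by
  let _ : TopologicalSpace (FreeGroup (Fin 2)) := ⊥
  have : DiscreteTopology (FreeGroup (Fin 2)) := ⟨rfl⟩
  let a : FreeGroup (Fin 2) := .of 0
  let b : FreeGroup (Fin 2) := .of 1
  obtain ⟨α, hα, hα'⟩ := exists_horizontalLoop (p := p) a b
  obtain ⟨β, hβ, hβ'⟩ := exists_verticalLoop (p := p) a b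
  let Ψ : FreeGroup (Fin 2) →* FundamentalGroup (PuncturedTorus p) (base p) :=
    FreeGroup.lift ![loopClass α, loopClass β]
  let Φ := ((isCoveringMap_bundle p a b).monodromyPerm (base p)).comp Ψ
  have hΦ (w g : FreeGroup (Fin 2)) : Φ w (fiberPoint a b .square (base p) g) =
      fiberPoint a b .square (base p) (w * g) := by
    induction w generalizing g with
    | C1 => simp
    | of i =>
      fin_cases i
      · simpa [Φ, Ψ] using! hα' g
      · simpa [Φ, Ψ] using! hβ' g
    | inv_of i ih => rw [map_inv, Equiv.Perm.inv_eq_iff_eq, ih, mul_inv_cancel_left]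
    | mul v w hv hw => rw [map_mul, Equiv.Perm.mul_apply, hw, hv, mul_assoc]
  refine ⟨MulEquiv.ofBijective Ψ ⟨(injective_iff_map_eq_one Ψ).mpr fun w hw ↦ ?_, fun g ↦ ?_⟩⟩
  · have h := hΦ w 1
    rw [MonoidHom.comp_apply, hw, map_one, Equiv.Perm.one_apply, mul_one] at h
    exact (fiberPoint_injective a b _ _ h).symm
  · exact mem_of_lifts hα hβ (H := Ψ.range) ⟨a, by simp [Ψ, a]⟩ ⟨b, by simp [Ψ, b]⟩ g

end

end PuncturedTorus

/-- The fundamental group of the punctured torus `((ℝ/ℤ) × (ℝ/ℤ)) ∖ {p}` at any base point is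
isomorphic to the free group on two generators. -/
theorem fundamentalGroup_punctured_torus (p : AddCircle (1 : ℝ) × AddCircle (1 : ℝ))
    (x₀ : ↥({p}ᶜ : Set (AddCircle (1 : ℝ) × AddCircle (1 : ℝ)))) :
    Nonempty (FundamentalGroup (↥({p}ᶜ : Set (AddCircle (1 : ℝ) × AddCircle (1 : ℝ)))) x₀ ≃*
      FreeGroup (Fin 2)) := by
  obtain ⟨e⟩ := PuncturedTorus.nonempty_freeGroup_mulEquiv_base p
  exact ⟨(e.trans (FundamentalGroup.fundamentalGroupMulEquivOfPath
    (PuncturedTorus.radial x₀))).symm⟩
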